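/- Let A be the weighted adjacency matrix of an undirected weighted graph with loops, and let S₁, …, S_p be pairwise disjoint subsets of vertices, with |S_t| = m_t ≥ 2, such that each S_t carries an (m_t,k_t,s_t)-star with loops, with loop weight ℓ_t and central weight a_t, and suppose ℓ_t − a_t = λ for all t. Then λ is an eigenvalue of A and the eigenspace ker(A − λ·I) has dimension at least Σ_{t=1}^{p} (m_t − 1). -/

import Mathlib

/-- If two distinct vertices `i`, `c` carry loops of the same weight, and every other vertex is joined
to both by edges of equal weight, then `e_i - e_c` is fixed by `A` up to the scalar
`A i i - A i c`. -/
theorem Matrix.IsSymm.mulVec_single_sub_single {V R : Type*} [Fintype V] [DecidableEq V] [CommRing R]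
    {A : Matrix V V R} (hA : A.IsSymm) {i c : V} (hdiag : A i i = A c c)
    (hout : ∀ l, l ≠ i → l ≠ c → A i l = A c l) :
    A.mulVec (Pi.single i 1 - Pi.single c 1) =
      (A i i - A i c) • (Pi.single i 1 - Pi.single c 1 : V → R) := by
  ext l
  rw [Matrix.mulVec_sub, Matrix.mulVec_single_one, Matrix.mulVec_single_one]
  simp only [Pi.sub_apply, Matrix.col_apply, Pi.smul_apply, smul_eq_mul, Pi.single_apply]
  by_cases hi : l = i
  · subst hi
    by_cases hc : l = c
    · subst hc
      simp
    · simp [hc]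
  · by_cases hc : l = c
    · subst hc
      simp [hi, hdiag, hA.apply i l]
    · simp [hi, hc, ← hA.apply l i, ← hA.apply l c, hout l hi hc]

/-- For disjoint sets `S t` with chosen points `c t ∈ S t`, the vectors `e_i - e_{c t}` with
`i ∈ S t`, `i ≠ c t` are linearly independent. -/
theorem linearIndependent_single_sub_single {V ι R : Type*} [Finite V] [DecidableEq V] [Finite ι]
    [CommRing R] (S : ι → Finset V) (hdisj : ∀ t t', t ≠ t' → Disjoint (S t) (S t'))
    (c : ι → V) (hc : ∀ t, c t ∈ S t) :
    LinearIndependent R (fun x : Σ t, (S t).erase (c t) =>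
      (Pi.single (x.2 : V) 1 - Pi.single (c x.1) 1 : V → R)) := by
  have hinj : ∀ {t t' : ι} {i : V}, i ∈ S t → i ∈ S t' → t = t' := by
    intro t t' i hi hi'
    by_contra hne
    exact Finset.disjoint_left.mp (hdisj t t' hne) hi hi'
  have := Fintype.ofFinite ι
  rw [Fintype.linearIndependent_iff]
  intro g hg y
  have hy := congrFun hg (y.2 : V)
  rw [Finset.sum_apply, Finset.sum_eq_single y] at hy
  · have hne := (Finset.mem_erase.mp y.2.2).1
    simpa [Pi.single_apply, hne] using hy
  · rintro ⟨t, i, hi⟩ - hne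
    obtain ⟨t', j, hj⟩ := y
    rw [Finset.mem_erase] at hi hj
    have hji : j ≠ i := by
      rintro rfl
      obtain rfl := hinj hi.2 hj.2
      exact hne rfl
    have hjc : j ≠ c t := by
      rintro rfl
      obtain rfl := hinj (hc t) hj.2
      exact hj.1 rfl
    simp [hji, hjc]
  · simp

/-- In a weighted graph possibly with loops, if pairwise disjoint subsets `S t`
(each of size `m t ≥ 2`) carry `(m_t,k_t,s_t)`-stars with loops, with loop weights `ℓ t` and
central weights `a t` such that `ℓ t - a t = lam` for all `t`, then `lam` is an eigenvalue
of the adjacency matrix `A` with eigenspace of dimension at least `∑ (m t - 1)`. -/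
theorem stmt_7 {n p : ℕ} (hp : 0 < p) (A : Matrix (Fin n) (Fin n) ℝ)
    (hsymm : A.IsSymm)
    (hnonneg : ∀ i j, 0 ≤ A i j)
    (S : Fin p → Finset (Fin n)) (m : Fin p → ℕ)
    (hm : ∀ t, 2 ≤ m t) (hcard : ∀ t, (S t).card = m t)
    (hdisj : ∀ t t', t ≠ t' → Disjoint (S t) (S t'))
    (ℓ a : Fin p → ℝ) (hℓ : ∀ t, 0 ≤ ℓ t) (ha : ∀ t, 0 ≤ a t)
    (hloop : ∀ t, ∀ i ∈ S t, A i i = ℓ t)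
    (hstar_center : ∀ t, ∀ i ∈ S t, ∀ j ∈ S t, i ≠ j → A i j = a t)
    (hstar_out : ∀ t, ∀ i ∈ S t, ∀ j ∈ S t, ∀ l, l ∉ S t → A i l = A j l)
    (lam : ℝ) (hlam : ∀ t, ℓ t - a t = lam) :
    Module.End.HasEigenvalue (Matrix.toLin' A) lam ∧
    (∑ t, (m t - 1)) ≤
      Module.finrank ℝ (Module.End.eigenspace (Matrix.toLin' A) lam) := by
  have hne : ∀ t, (S t).Nonempty := fun t => by
    rw [← Finset.card_pos, hcard t]
    have := hm t
    lia
  choose c hc using hne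
  set E := Module.End.eigenspace (Matrix.toLin' A) lam with hE
  have hmem : ∀ x : Σ t, (S t).erase (c t),
      (Pi.single (x.2 : Fin n) 1 - Pi.single (c x.1) 1 : Fin n → ℝ) ∈ E := by
    rintro ⟨t, i, hi⟩
    obtain ⟨hic, hiS⟩ := Finset.mem_erase.mp hi
    rw [hE, Module.End.mem_eigenspace_iff, Matrix.toLin'_apply,
      hsymm.mulVec_single_sub_single, hloop t i hiS, hstar_center t i hiS _ (hc t) hic, hlam t]
    · rw [hloop t i hiS, hloop t _ (hc t)]
    · intro l hli hlc
      by_cases hl : l ∈ S t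
      · rw [hstar_center t i hiS l hl hli.symm, hstar_center t _ (hc t) l hl hlc.symm]
      · exact hstar_out t i hiS _ (hc t) l hl
  have hdim : (∑ t, (m t - 1)) ≤ Module.finrank ℝ E := by
    have hli := linearIndependent_single_sub_single (R := ℝ) S hdisj c hc
    calc (∑ t, (m t - 1)) = Fintype.card (Σ t, (S t).erase (c t)) := by
          simp only [Fintype.card_sigma, Fintype.card_coe, Finset.card_erase_of_mem (hc _), hcard]
      _ = Module.finrank ℝ (Submodule.span ℝ (Set.range _)) := (finrank_span_eq_card hli).symm
      _ ≤ Module.finrank ℝ E := Submodule.finrank_mono <| by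
          rw [Submodule.span_le]
          rintro _ ⟨x, rfl⟩
          exact hmem x
  refine ⟨fun hbot => ?_, hdim⟩
  have hpos : 0 < ∑ t, (m t - 1) :=
    Finset.sum_pos (fun t _ => Nat.sub_pos_of_lt (hm t)) ⟨⟨0, hp⟩, Finset.mem_univ _⟩
  have hzero : Module.finrank ℝ E = 0 := by
    rw [hE, show Module.End.eigenspace (Matrix.toLin' A) lam = ⊥ from hbot, finrank_bot]
  lia
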